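/- Let (Ω, 𝒜, μ) be a probability space and 𝔉 : ℕ → sub-σ-algebras of 𝒜 a filtration (𝔉 s ⊆ 𝔉 (s+1) for all s). Let M be a nonempty finite set, u ∈ M, and π₀ : M → ℝ with π₀ m > 0 for all m and ∑_{m∈M} π₀ m = 1. For each m ∈ M let X m : ℕ → Ω → ℝ be a sequence of square-integrable random variables such that X m s is 𝔉(s+1)-measurable, and such that X u s = 0 identically for all s. Assume: (i) for each m ≠ u, sup_{s ∈ ℕ} μ[ ( X m s − μ[X m s | 𝔉 s] )² ] < ∞; and (ii) for each m ≠ u there exists κ_m > 0 such that μ-almost surely, liminf_{T→∞} (1/T) ∑_{s=0}^{T−1} μ[ X m s | 𝔉 s ] ≥ κ_m. Define the posterior π_t m ω := ( π₀ m · exp( − ∑_{s<t} X m s ω ) ) / ( ∑_{m'∈M} π₀ m' · exp( − ∑_{s<t} X m' s ω ) ). Then μ-almost surely, π_t u ω → 1 as t → ∞, and hence max_{m ∈ M, m ≠ u} π_t m ω → 0 μ-almost surely. (Payoff posterior concentration under known-noise KL separation: X m s plays the role of the per-round log-likelihood ratio log(ψ(r_s; u(a_s)) / ψ(r_s; m(a_s)))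 of the true payoff kernel against the candidate mean payoff matrix m, so that π_t is exactly the Bayes posterior over the finite payoff menu.) -/

import Mathlib

open MeasureTheory Filter

/-- A special case of Kronecker's lemma: if `∑ y s / (s + 1)` converges, then the averages of `y`
tend to zero. -/
theorem tendsto_average_zero_of_tendsto_sum_div {y : ℕ → ℝ} {c : ℝ}
    (h : Tendsto (fun n : ℕ => ∑ s ∈ Finset.range n, y s / ((s : ℝ) + 1)) atTop (nhds c)) :
    Tendsto (fun n : ℕ => (1 / (n : ℝ)) * ∑ s ∈ Finset.range n, y s) atTop (nhds 0) := by
  set N : ℕ → ℝ := fun n => ∑ s ∈ Finset.range n, y s / ((s : ℝ) + 1) with hN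
  have abel (n : ℕ) : ∑ s ∈ Finset.range n, y s = n * N n - ∑ s ∈ Finset.range n, N s := by
    induction n with
    | zero => simp
    | succ n ih =>
      have hsucc : N (n + 1) = N n + y n / ((n : ℝ) + 1) := Finset.sum_range_succ _ _
      have hpos : (n : ℝ) + 1 ≠ 0 := by positivity
      rw [Finset.sum_range_succ, Finset.sum_range_succ, ih, hsucc]
      push_cast
      field_simp
      ring
  have hlim := h.sub h.cesaro
  rw [sub_self] at hlim
  refine hlim.congr' ?_
  filter_upwards [eventually_gt_atTop 0] with n hn
  have hn' : (n : ℝ) ≠ 0 := by positivity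
  rw [abel]
  field_simp

section MartingaleDifference

variable {Ω : Type*} {m0 : MeasurableSpace Ω} {μ : Measure Ω}

/-- A square-integrable variable with vanishing conditional expectation given `m` is orthogonal to
every square-integrable `m`-measurable variable. -/
theorem integral_mul_eq_zero_of_condExp_eq_zero [IsFiniteMeasure μ] {m : MeasurableSpace Ω}
    (hm : m ≤ m0) {f g : Ω → ℝ} (hf : StronglyMeasurable[m] f) (hf2 : MemLp f 2 μ)
    (hg2 : MemLp g 2 μ) (hg : μ[g | m] =ᵐ[μ] 0) : ∫ ω, f ω * g ω ∂μ = 0 := by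
  have hint : Integrable (f * g) μ := hf2.integrable_mul hg2
  have hpull := condExp_mul_of_stronglyMeasurable_left hf hint (hg2.integrable one_le_two)
  calc ∫ ω, f ω * g ω ∂μ = ∫ ω, (μ[f * g | m]) ω ∂μ := (integral_condExp hm).symm
    _ = ∫ _, (0 : ℝ) ∂μ := integral_congr_ae <| by
      filter_upwards [hpull, hg] with ω h1 h2
      rw [h1, Pi.mul_apply, h2, Pi.zero_apply, mul_zero]
    _ = 0 := integral_zero _ _

/-- The strong law of large numbers for martingale differences with bounded second moments. -/
theorem ae_tendsto_average_zero_of_condExp_eq_zero [IsProbabilityMeasure μ]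
    (𝒢 : Filtration ℕ m0) {Y : ℕ → Ω → ℝ} {C : ℝ}
    (hY : ∀ s, StronglyMeasurable[𝒢 (s + 1)] (Y s)) (hY2 : ∀ s, MemLp (Y s) 2 μ)
    (hY0 : ∀ s, μ[Y s | 𝒢 s] =ᵐ[μ] 0) (hC : ∀ s, ∫ ω, Y s ω ^ 2 ∂μ ≤ C) :
    ∀ᵐ ω ∂μ, Tendsto (fun n : ℕ => (1 / (n : ℝ)) * ∑ s ∈ Finset.range n, Y s ω)
      atTop (nhds 0) := by
  set N : ℕ → Ω → ℝ := fun n ω => ∑ s ∈ Finset.range n, Y s ω / ((s : ℝ) + 1) with hN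
  have hsucc (n : ℕ) (ω : Ω) : N (n + 1) ω = N n ω + Y n ω / ((n : ℝ) + 1) :=
    Finset.sum_range_succ _ _
  have hadp : StronglyAdapted 𝒢 N := fun n =>
    Finset.stronglyMeasurable_fun_sum _ fun s hs => by
      simpa only [div_eq_inv_mul] using
        StronglyMeasurable.const_mul ((hY s).mono (𝒢.mono (Finset.mem_range.mp hs)))
          (((s : ℝ) + 1)⁻¹)
  have hN2 (n : ℕ) : MemLp (N n) 2 μ :=
    memLp_finsetSum _ fun s _ => by
      simpa only [div_eq_inv_mul] using (hY2 s).const_mul (((s : ℝ) + 1)⁻¹)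
  have hmart : Martingale N 𝒢 μ := by
    refine martingale_of_condExp_sub_eq_zero_nat hadp
      (fun n => (hN2 n).integrable one_le_two) fun n => ?_
    have hdiff : N (n + 1) - N n = ((n : ℝ) + 1)⁻¹ • Y n := by
      ext ω
      simp only [Pi.sub_apply, hsucc, Pi.smul_apply, smul_eq_mul]
      ring
    rw [hdiff]
    filter_upwards [condExp_smul (μ := μ) (((n : ℝ) + 1)⁻¹) (Y n) (𝒢 n), hY0 n] with ω h1 h2
    simp [h1, h2]
  have hC0 : 0 ≤ C := (integral_nonneg fun ω => sq_nonneg (Y 0 ω)).trans (hC 0)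
  have hbound (n : ℕ) :
      ∫ ω, N n ω ^ 2 ∂μ ≤ ∑ s ∈ Finset.range n, C * (1 / ((s : ℝ) + 1) ^ 2) := by
    induction n with
    | zero => simp [hN]
    | succ n ih =>
      have hcross := integral_mul_eq_zero_of_condExp_eq_zero (𝒢.le n) (hadp n) (hN2 n) (hY2 n)
        (hY0 n)
      have hi1 : Integrable (fun ω => N n ω ^ 2) μ := (hN2 n).integrable_sq
      have hi2 : Integrable (fun ω => (2 / ((n : ℝ) + 1)) * (N n ω * Y n ω)) μ :=
        ((hN2 n).integrable_mul (hY2 n)).const_mul _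
      have hi12 : Integrable (fun ω => N n ω ^ 2 + (2 / ((n : ℝ) + 1)) * (N n ω * Y n ω)) μ :=
        hi1.add hi2
      have hi3 : Integrable (fun ω => (1 / ((n : ℝ) + 1) ^ 2) * Y n ω ^ 2) μ :=
        (hY2 n).integrable_sq.const_mul _
      have hexp : (fun ω => N (n + 1) ω ^ 2) = fun ω => N n ω ^ 2 +
          (2 / ((n : ℝ) + 1)) * (N n ω * Y n ω) + (1 / ((n : ℝ) + 1) ^ 2) * Y n ω ^ 2 := by
        ext ω
        rw [hsucc]
        field_simp
        ring
      rw [hexp, integral_add hi12 hi3, integral_add hi1 hi2, integral_const_mul,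
        integral_const_mul, hcross, Finset.sum_range_succ, mul_zero, add_zero, mul_comm C]
      gcongr
      exact hC n
  have hsum : Summable fun s : ℕ => C * (1 / ((s : ℝ) + 1) ^ 2) := by
    have := (summable_nat_add_iff 1).mpr (Real.summable_one_div_nat_pow.mpr one_lt_two)
    exact (by simpa using this : Summable fun s : ℕ => 1 / ((s : ℝ) + 1) ^ 2).mul_left C
  set R : ℝ := ∑' s : ℕ, C * (1 / ((s : ℝ) + 1) ^ 2)
  have hbdd (n : ℕ) : eLpNorm (N n) 1 μ ≤ ((1 + R).toNNReal : ENNReal) := by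
    rw [eLpNorm_one_eq_lintegral_enorm,
      ← ofReal_integral_norm_eq_lintegral_enorm ((hN2 n).integrable one_le_two)]
    refine ENNReal.ofReal_le_ofReal ?_
    calc ∫ ω, ‖N n ω‖ ∂μ ≤ ∫ ω, (1 + N n ω ^ 2) ∂μ := by
          refine integral_mono ((hN2 n).integrable one_le_two).norm
            ((integrable_const 1).add (hN2 n).integrable_sq) fun ω => ?_
          rw [Real.norm_eq_abs, ← sq_abs (N n ω)]
          nlinarith [sq_nonneg (|N n ω| - 1), abs_nonneg (N n ω)]
      _ = 1 + ∫ ω, N n ω ^ 2 ∂μ := by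
          rw [integral_add (integrable_const 1) (hN2 n).integrable_sq]
          simp
      _ ≤ 1 + R := by
          gcongr
          exact (hbound n).trans (hsum.sum_le_tsum _ fun s _ => by positivity)
  filter_upwards [hmart.submartingale.exists_ae_tendsto_of_bdd hbdd] with ω ⟨c, hc⟩
  exact tendsto_average_zero_of_tendsto_sum_div hc

end MartingaleDifference

/-- A positive real `liminf` forces an eventual positive lower bound. -/
theorem exists_pos_eventually_le_of_liminf_pos {a : ℕ → ℝ} (h : 0 < liminf a atTop) :
    ∃ δ > 0, ∀ᶠ n in atTop, δ ≤ a n := by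
  by_contra hcon
  rw [liminf_eq] at h
  refine h.not_ge (Real.sSup_nonpos fun δ hδ => ?_)
  by_contra! hpos
  exact hcon ⟨δ, hpos, hδ⟩

/-- If the averages of `a` have positive `liminf` and those of `x - a` tend to zero, then the
partial sums of `x` diverge to infinity. -/
theorem tendsto_sum_atTop_of_liminf_average_pos {x a : ℕ → ℝ}
    (ha : 0 < liminf (fun n : ℕ => (1 / (n : ℝ)) * ∑ s ∈ Finset.range n, a s) atTop)
    (hxa : Tendsto (fun n : ℕ => (1 / (n : ℝ)) * ∑ s ∈ Finset.range n, (x s - a s))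
      atTop (nhds 0)) :
    Tendsto (fun n : ℕ => ∑ s ∈ Finset.range n, x s) atTop atTop := by
  obtain ⟨δ, hδ, hev⟩ := exists_pos_eventually_le_of_liminf_pos ha
  refine tendsto_atTop_mono' atTop ?_
    (tendsto_natCast_atTop_atTop.atTop_mul_const (half_pos hδ))
  filter_upwards [hev, hxa.eventually_const_le (show -(δ / 2) < 0 by linarith),
    eventually_gt_atTop 0] with n h1 h2 hn
  have hn' : (0 : ℝ) < n := by exact_mod_cast hn
  have havg : δ / 2 ≤ (1 / (n : ℝ)) * ∑ s ∈ Finset.range n, x s := by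
    rw [Finset.sum_sub_distrib, mul_sub] at h2
    linarith
  rwa [one_div, inv_mul_eq_div, le_div_iff₀ hn', mul_comm] at havg

/-- Normalized nonnegative weights over a finite type concentrate on `u` if the weight of `u` has a
positive limit and all other weights tend to zero. -/
theorem tendsto_normalized_weights {M : Type*} [Fintype M] {w : M → ℕ → ℝ} {u : M} {p : ℝ}
    (hp : 0 < p) (hw : ∀ m t, 0 ≤ w m t) (hu : Tendsto (w u) atTop (nhds p))
    (h0 : ∀ m, m ≠ u → Tendsto (w m) atTop (nhds 0)) :
    Tendsto (fun t => w u t / ∑ m', w m' t) atTop (nhds 1) ∧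
      Tendsto (fun t => ⨆ m : {m : M // m ≠ u}, w m.1 t / ∑ m', w m' t) atTop (nhds 0) := by
  classical
  have hden : Tendsto (fun t => ∑ m', w m' t) atTop (nhds p) := by
    have := tendsto_finsetSum (Finset.univ : Finset M)
      (f := w) (a := fun m => if m = u then p else 0) (x := atTop) fun m _ => by
        by_cases hm : m = u
        · simpa [hm] using hu
        · simpa [hm] using h0 m hm
    simpa using this
  have hnonneg (m : M) (t : ℕ) : 0 ≤ w m t / ∑ m', w m' t :=
    div_nonneg (hw m t) (Finset.sum_nonneg fun m' _ => hw m' t)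
  refine ⟨div_self hp.ne' ▸ hu.div hden hp.ne', ?_⟩
  have hrest : Tendsto (fun t => ∑ m : {m : M // m ≠ u}, w m.1 t / ∑ m', w m' t) atTop
      (nhds 0) := by
    have := tendsto_finsetSum (Finset.univ : Finset {m : M // m ≠ u})
      fun m _ => (h0 m.1 m.2).div hden hp.ne'
    simpa using this
  refine squeeze_zero (fun t => Real.iSup_nonneg fun m => hnonneg m.1 t) (fun t => ?_) hrest
  exact Real.iSup_le (fun m => Finset.single_le_sum
    (f := fun m : {m : M // m ≠ u} => w m.1 t / ∑ m', w m' t)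
    (fun m _ => hnonneg m.1 t) (Finset.mem_univ m)) (Finset.sum_nonneg fun m _ => hnonneg m.1 t)

/-- **Payoff posterior concentration under known-noise KL separation.**
`X m s` plays the role of the per-round log-likelihood ratio of the true payoff
kernel against the candidate mean payoff matrix `m` (so `X u s = 0` for the true
hypothesis `u`), and `π_t` is exactly the Bayes posterior over the finite payoff
menu. Under a uniform bound on the conditional-centered second moments and the
on-path KL-separation condition, the posterior concentrates on `u` almost surely. -/
theorem payoff_posterior_concentration {Ω : Type*} [m0 : MeasurableSpace Ω]
    (μ : Measure Ω) [IsProbabilityMeasure μ]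
    (F : ℕ → MeasurableSpace Ω) (hF_le : ∀ s, F s ≤ m0) (hF_mono : ∀ s, F s ≤ F (s + 1))
    {M : Type*} [Fintype M] [Nonempty M] (u : M)
    (π₀ : M → ℝ) (hπ₀ : ∀ m, 0 < π₀ m) (hπ₀sum : ∑ m, π₀ m = 1)
    (X : M → ℕ → Ω → ℝ)
    (hL2 : ∀ m s, MemLp (X m s) 2 μ)
    (hmeas : ∀ m s, Measurable[F (s + 1)] (X m s))
    (hXu : ∀ s ω, X u s ω = 0)
    (hvar : ∀ m, m ≠ u → ∃ C : ℝ, ∀ s,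
      (∫ ω, (X m s ω - (μ[X m s | F s]) ω) ^ 2 ∂μ) ≤ C)
    (hKL : ∀ m, m ≠ u → ∃ κ > (0 : ℝ), ∀ᵐ ω ∂μ,
      κ ≤ atTop.liminf fun T : ℕ =>
        (1 / (T : ℝ)) * ∑ s ∈ Finset.range T, (μ[X m s | F s]) ω) :
    ∀ᵐ ω ∂μ,
      Tendsto (fun t : ℕ =>
          (π₀ u * Real.exp (-∑ s ∈ Finset.range t, X u s ω)) /
            ∑ m', π₀ m' * Real.exp (-∑ s ∈ Finset.range t, X m' s ω))
        atTop (nhds 1) ∧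
      Tendsto (fun t : ℕ =>
          ⨆ m : {m : M // m ≠ u},
            (π₀ m.1 * Real.exp (-∑ s ∈ Finset.range t, X m.1 s ω)) /
              ∑ m', π₀ m' * Real.exp (-∑ s ∈ Finset.range t, X m' s ω))
        atTop (nhds 0) := by
  let 𝒢 : Filtration ℕ m0 := ⟨F, monotone_nat_of_le_succ hF_mono, hF_le⟩
  have hdiv (m : M) (hm : m ≠ u) : ∀ᵐ ω ∂μ,
      Tendsto (fun t : ℕ => ∑ s ∈ Finset.range t, X m s ω) atTop atTop := by
    obtain ⟨C, hC⟩ := hvar m hm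
    obtain ⟨κ, hκ, hlim⟩ := hKL m hm
    have hcenter (s : ℕ) : μ[X m s - μ[X m s | F s] | F s] =ᵐ[μ] 0 := by
      have hint := (hL2 m s).integrable one_le_two
      have hsub := condExp_sub hint integrable_condExp (F s) (μ := μ) (g := μ[X m s | F s])
      rw [condExp_of_stronglyMeasurable (hF_le s) stronglyMeasurable_condExp
        integrable_condExp, sub_self] at hsub
      exact hsub
    have hslln := ae_tendsto_average_zero_of_condExp_eq_zero (μ := μ) 𝒢
      (Y := fun s => X m s - μ[X m s | F s]) (C := C)
      (fun s => (hmeas m s).stronglyMeasurable.sub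
        (stronglyMeasurable_condExp.mono (hF_mono s)))
      (fun s => (hL2 m s).sub ((hL2 m s).condExp one_le_two)) hcenter hC
    filter_upwards [hlim, hslln] with ω h1 h2
    exact tendsto_sum_atTop_of_liminf_average_pos (hκ.trans_le h1) h2
  have hall : ∀ᵐ ω ∂μ, ∀ m, m ≠ u →
      Tendsto (fun t : ℕ => ∑ s ∈ Finset.range t, X m s ω) atTop atTop := by
    refine ae_all_iff.mpr fun m => ?_
    by_cases hm : m = u
    · exact Eventually.of_forall fun ω h => absurd hm h
    · filter_upwards [hdiv m hm] with ω hω _ using hω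
  filter_upwards [hall] with ω hω
  refine tendsto_normalized_weights
    (w := fun m t => π₀ m * Real.exp (-∑ s ∈ Finset.range t, X m s ω)) (hπ₀ u)
    (fun m t => mul_nonneg (hπ₀ m).le (Real.exp_pos _).le) ?_ fun m hm => ?_
  · simp [hXu]
  · simpa using (Real.tendsto_exp_neg_atTop_nhds_zero.comp (hω m hm)).const_mul (π₀ m)
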